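/- For every real z > 1/2, the trigamma function satisfies ψ′(z) = ∑_{n≥0} 1/(z+n)², and the continued fraction [[0, (2z−1)(2n−1)], [2, n⁴]] converges to ψ′(z); i.e., the convergents p(N)/q(N) defined by p(0)=0, q(0)=1, p(1)=2, q(1)=(2z−1), and p(n) = (2z−1)(2n−1)p(n−1) + (n−1)⁴p(n−2), q(n) = (2z−1)(2n−1)q(n−1) + (n−1)⁴q(n−2) for n ≥ 2, satisfy lim_{N→∞} p(N)/q(N) = ψ′(z). -/

import Mathlib

/-- The trigamma function: second derivative of `log ∘ Γ` on the reals. -/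
noncomputable def trigamma (z : ℝ) : ℝ :=
  iteratedDeriv 2 (fun x : ℝ => Real.log (Real.Gamma x)) z

open Filter Topology

theorem log_Gamma_differentiableAt {x : ℝ} (hx : 0 < x) :
    DifferentiableAt ℝ (fun y : ℝ => Real.log (Real.Gamma y)) x :=
  (Real.differentiableAt_Gamma fun m => by
    have : (0 : ℝ) ≤ m := m.cast_nonneg
    linarith).log (Real.Gamma_pos_of_pos hx).ne'

theorem deriv_log_Gamma_add_one {x : ℝ} (hx : 0 < x) :
    deriv (fun y : ℝ => Real.log (Real.Gamma y)) (x + 1) =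
      deriv (fun y : ℝ => Real.log (Real.Gamma y)) x + 1 / x := by
  rw [← deriv_comp_add_const (fun y : ℝ => Real.log (Real.Gamma y)) 1 x]
  have h : (fun y : ℝ => Real.log (Real.Gamma (y + 1))) =ᶠ[𝓝 x]
      fun y => Real.log (Real.Gamma y) + Real.log y := by
    filter_upwards [lt_mem_nhds hx] with y hy
    rw [Real.Gamma_add_one hy.ne', Real.log_mul hy.ne' (Real.Gamma_pos_of_pos hy).ne', add_comm]
  rw [h.deriv_eq]
  have := (log_Gamma_differentiableAt hx).hasDerivAt.add (Real.hasDerivAt_log hx.ne')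
  rw [one_div]
  exact this.deriv

theorem deriv_log_Gamma_add_nat {x : ℝ} (hx : 0 < x) (N : ℕ) :
    deriv (fun y : ℝ => Real.log (Real.Gamma y)) (x + N) =
      deriv (fun y : ℝ => Real.log (Real.Gamma y)) x + ∑ n ∈ Finset.range N, 1 / (x + n) := by
  induction N with
  | zero => simp
  | succ N ih =>
    rw [Finset.sum_range_succ, ← add_assoc, ← ih, ← deriv_log_Gamma_add_one (by positivity)]
    push_cast
    ring_nf

theorem monotoneOn_deriv_log_Gamma :
    MonotoneOn (deriv fun y : ℝ => Real.log (Real.Gamma y)) (Set.Ioi 0) := by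
  have h := Real.convexOn_log_Gamma
  exact h.monotoneOn_deriv fun x hx => log_Gamma_differentiableAt hx

theorem tendsto_deriv_log_Gamma_add_nat_sub {x y : ℝ} (hx : 0 < x) (hxy : x ≤ y) :
    Tendsto (fun N : ℕ => deriv (fun y : ℝ => Real.log (Real.Gamma y)) (y + N) -
      deriv (fun y : ℝ => Real.log (Real.Gamma y)) (x + N)) atTop (𝓝 0) := by
  obtain ⟨k, hk⟩ := exists_nat_ge (y - x)
  have hlim : Tendsto (fun N : ℕ => ∑ n ∈ Finset.range k, 1 / (x + N + n)) atTop (𝓝 0) := by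
    rw [← Finset.sum_const_zero (s := Finset.range k) (ι := ℕ)]
    refine tendsto_finsetSum _ fun n _ => ?_
    simp only [one_div]
    refine Tendsto.inv_tendsto_atTop ?_
    exact tendsto_atTop_add_const_right _ _
      (tendsto_atTop_add_const_left _ _ tendsto_natCast_atTop_atTop)
  refine tendsto_of_tendsto_of_tendsto_of_le_of_le tendsto_const_nhds hlim ?_ ?_
  · intro N
    have h0 : (0 : ℝ) ≤ N := N.cast_nonneg
    exact sub_nonneg.2 (monotoneOn_deriv_log_Gamma (Set.mem_Ioi.2 (by linarith))
      (Set.mem_Ioi.2 (by linarith)) (by linarith))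
  · intro N
    have h0 : (0 : ℝ) ≤ N := N.cast_nonneg
    have h1 := deriv_log_Gamma_add_nat (x := x + N) (by linarith) k
    have h2 := monotoneOn_deriv_log_Gamma (a := y + N) (b := x + N + k)
      (Set.mem_Ioi.2 (by linarith)) (Set.mem_Ioi.2 (by linarith)) (by linarith)
    simp only at h2 ⊢
    linarith

theorem summable_one_div_add_nat_sq {x : ℝ} (hx : 0 < x) :
    Summable fun n : ℕ => 1 / (x + n) ^ 2 := by
  refine ((Real.summable_one_div_nat_add_rpow x 2).2 one_lt_two).congr fun n => ?_
  rw [abs_of_pos (by positivity), Real.rpow_two, add_comm]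

/-- The increments of the derivative of `log ∘ Γ` as a series of nonnegative terms. -/
theorem hasSum_deriv_log_Gamma_sub {a x : ℝ} (ha : 0 < a) (hax : a ≤ x) :
    HasSum (fun n : ℕ => 1 / (a + n) - 1 / (x + n))
      (deriv (fun y : ℝ => Real.log (Real.Gamma y)) x -
        deriv (fun y : ℝ => Real.log (Real.Gamma y)) a) := by
  rw [hasSum_iff_tendsto_nat_of_nonneg]
  · have h := (tendsto_deriv_log_Gamma_add_nat_sub ha hax).const_sub
      (deriv (fun y : ℝ => Real.log (Real.Gamma y)) x -
        deriv (fun y : ℝ => Real.log (Real.Gamma y)) a)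
    rw [sub_zero] at h
    refine h.congr fun N => ?_
    rw [deriv_log_Gamma_add_nat ha, deriv_log_Gamma_add_nat (ha.trans_le hax),
      Finset.sum_sub_distrib]
    ring
  · intro n
    exact sub_nonneg.2 (one_div_le_one_div_of_le (by positivity) (by linarith))

theorem hasDerivAt_deriv_log_Gamma {x : ℝ} (hx : 0 < x) :
    HasDerivAt (deriv fun y : ℝ => Real.log (Real.Gamma y)) (∑' n : ℕ, 1 / (x + n) ^ 2) x := by
  have ha : 0 < x / 2 := by positivity
  have hmem : x ∈ Set.Ioi (x / 2) := Set.mem_Ioi.2 (by linarith)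
  have h := hasDerivAt_tsum_of_isPreconnected (summable_one_div_add_nat_sq ha)
    isOpen_Ioi isPreconnected_Ioi
    (g := fun (n : ℕ) (y : ℝ) => 1 / (x / 2 + n) - 1 / (y + n))
    (g' := fun (n : ℕ) (y : ℝ) => 1 / (y + n) ^ 2) (t := Set.Ioi (x / 2)) (y₀ := x) (y := x)
    (fun n y hy => by
      have hy' : 0 < y := ha.trans hy
      have hne : y + n ≠ 0 := by positivity
      have := (((hasDerivAt_id y).add_const (n : ℝ)).inv hne).const_sub (1 / (x / 2 + n))
      simpa [one_div, neg_div] using this)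
    (fun n y hy => by
      have hy' : x / 2 < y := hy
      rw [Real.norm_of_nonneg (by positivity)]
      gcongr)
    hmem (hasSum_deriv_log_Gamma_sub ha hmem.le).summable hmem
  refine (h.add_const (deriv (fun y : ℝ => Real.log (Real.Gamma y)) (x / 2))).congr_of_eventuallyEq
    ?_
  filter_upwards [lt_mem_nhds (show x / 2 < x from hmem)] with y hy
  rw [(hasSum_deriv_log_Gamma_sub ha (le_of_lt hy)).tsum_eq]
  ring

theorem trigamma_eq_tsum {z : ℝ} (hz : 0 < z) : trigamma z = ∑' n : ℕ, 1 / (z + n) ^ 2 := by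
  rw [trigamma, iteratedDeriv_succ, iteratedDeriv_one]
  exact (hasDerivAt_deriv_log_Gamma hz).deriv

/-- The solution of `(n + 2)² u (n + 2) = x (2n + 3) u (n + 1) + (n + 1)² u n` with initial values
`a`, `b`: the numerators and denominators of the continued fraction divided by `(n!)²`. -/
noncomputable def cfSeq (x a b : ℝ) : ℕ → ℝ
  | 0 => a
  | 1 => b
  | n + 2 => (x * (2 * n + 3) * cfSeq x a b (n + 1) + ((n : ℝ) + 1) ^ 2 * cfSeq x a b n) /
      ((n : ℝ) + 2) ^ 2

theorem cfSeq_rec (x a b : ℝ) (n : ℕ) :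
    ((n : ℝ) + 2) ^ 2 * cfSeq x a b (n + 2) =
      x * (2 * n + 3) * cfSeq x a b (n + 1) + ((n : ℝ) + 1) ^ 2 * cfSeq x a b n := by
  rw [cfSeq, mul_div_cancel₀ _ (by positivity)]

theorem eq_cfSeq {x : ℝ} {u : ℕ → ℝ}
    (hu : ∀ n : ℕ, ((n : ℝ) + 2) ^ 2 * u (n + 2) =
      x * (2 * n + 3) * u (n + 1) + ((n : ℝ) + 1) ^ 2 * u n) (n : ℕ) :
    u n = cfSeq x (u 0) (u 1) n := by
  induction n using Nat.twoStepInduction with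
  | zero => rfl
  | one => rfl
  | more n h0 h1 =>
    have h2 : ((n : ℝ) + 2) ^ 2 ≠ 0 := by positivity
    apply mul_left_cancel₀ h2
    rw [hu, cfSeq_rec, ← h0, ← h1]

theorem eq_factorial_sq_mul_cfSeq {x : ℝ} {u : ℕ → ℝ}
    (hu : ∀ n : ℕ, u (n + 2) = x * (2 * n + 3) * u (n + 1) + ((n : ℝ) + 1) ^ 4 * u n) (n : ℕ) :
    u n = (n.factorial : ℝ) ^ 2 * cfSeq x (u 0) (u 1) n := by
  induction n using Nat.twoStepInduction with
  | zero => simp [cfSeq]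
  | one => simp [cfSeq]
  | more n h0 h1 =>
    rw [hu, h0, h1, Nat.factorial_succ (n + 1), Nat.factorial_succ n]
    push_cast
    linear_combination (-(((n : ℝ) + 1) * n.factorial) ^ 2) * cfSeq_rec x (u 0) (u 1) n

theorem cfSeq_nonneg {x a b : ℝ} (hx : 0 ≤ x) (ha : 0 ≤ a) (hb : 0 ≤ b) (n : ℕ) :
    0 ≤ cfSeq x a b n := by
  induction n using Nat.twoStepInduction with
  | zero => exact ha
  | one => exact hb
  | more n h0 h1 => rw [cfSeq]; positivity

theorem cfSeq_pos {x a b : ℝ} (hx : 0 < x) (ha : 0 < a) (hb : 0 < b) (n : ℕ) :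
    0 < cfSeq x a b n := by
  induction n using Nat.twoStepInduction with
  | zero => exact ha
  | one => exact hb
  | more n h0 h1 => rw [cfSeq]; positivity

theorem cfSeq_le {x : ℝ} (hx : 0 < x) (n : ℕ) :
    cfSeq x 0 2 n ≤ 2 / x * cfSeq x 1 x n := by
  have h := eq_cfSeq (x := x) (u := fun n => 2 * cfSeq x 1 x n - x * cfSeq x 0 2 n)
    (fun n => by linear_combination 2 * cfSeq_rec x 1 x n - x * cfSeq_rec x 0 2 n) n
  have h0 : 0 ≤ 2 * cfSeq x 1 x n - x * cfSeq x 0 2 n := by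
    rw [h]
    apply cfSeq_nonneg hx.le <;> simp [cfSeq, mul_comm]
  rw [div_mul_eq_mul_div, le_div_iff₀ hx]
  linarith

/-- The determinant formula for consecutive convergents. -/
theorem cfSeq_det (x : ℝ) (n : ℕ) :
    ((n : ℝ) + 1) ^ 2 * (cfSeq x 0 2 (n + 1) * cfSeq x 1 x n - cfSeq x 0 2 n * cfSeq x 1 x (n + 1)) =
      (-1) ^ n * 2 := by
  induction n with
  | zero => simp [cfSeq]
  | succ n ih =>
    push_cast
    rw [pow_succ]
    linear_combination (-1) * ih + cfSeq x 1 x (n + 1) * cfSeq_rec x 0 2 n -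
      cfSeq x 0 2 (n + 1) * cfSeq_rec x 1 x n

theorem cfSeq_mul_succ_rec (x : ℝ) (n : ℕ) :
    ((n : ℝ) + 2) ^ 2 * (cfSeq x 1 x (n + 2) * cfSeq x 1 x (n + 1)) =
      ((n : ℝ) + 1) ^ 2 * (cfSeq x 1 x (n + 1) * cfSeq x 1 x n) +
        x * (2 * n + 3) * cfSeq x 1 x (n + 1) ^ 2 := by
  linear_combination cfSeq x 1 x (n + 1) * cfSeq_rec x 1 x n

theorem le_cfSeq_mul_succ {x : ℝ} (hx : 0 < x) (n : ℕ) :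
    x ≤ ((n : ℝ) + 1) ^ 2 * (cfSeq x 1 x (n + 1) * cfSeq x 1 x n) := by
  induction n with
  | zero => simp [cfSeq]
  | succ n ih =>
    have h := cfSeq_mul_succ_rec x n
    have h1 : 0 ≤ x * (2 * n + 3) * cfSeq x 1 x (n + 1) ^ 2 := by positivity
    push_cast
    rw [add_assoc (n : ℝ) 1 1, one_add_one_eq_two]
    linarith

theorem cfSeq_mul_succ_add_le {x : ℝ} (hx : 0 < x) (n : ℕ) :
    ((n : ℝ) + 1) ^ 2 * (cfSeq x 1 x (n + 1) * cfSeq x 1 x n) + x ^ 2 * (1 / ((n : ℝ) + 1)) ≤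
      ((n : ℝ) + 3) ^ 2 * (cfSeq x 1 x (n + 3) * cfSeq x 1 x (n + 2)) := by
  have h1 := cfSeq_mul_succ_rec x n
  have h2 := cfSeq_mul_succ_rec x (n + 1)
  have h3 := le_cfSeq_mul_succ hx (n + 1)
  push_cast at h2 h3
  set A := cfSeq x 1 x (n + 1)
  set B := cfSeq x 1 x (n + 2)
  have h4 : 2 * (B * A) ≤ A ^ 2 + B ^ 2 := by nlinarith [sq_nonneg (A - B)]
  have h5 : x / ((n : ℝ) + 2) ^ 2 ≤ B * A := by
    rw [div_le_iff₀ (by positivity)]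
    linarith
  have h6 : x ^ 2 * (1 / ((n : ℝ) + 1)) ≤ x * (2 * n + 3) * (2 * (x / ((n : ℝ) + 2) ^ 2)) := by
    have : x * (2 * n + 3) * (2 * (x / ((n : ℝ) + 2) ^ 2)) =
      x ^ 2 * ((2 * n + 3) * 2 / ((n : ℝ) + 2) ^ 2) := by ring
    rw [this]
    refine mul_le_mul_of_nonneg_left ?_ (sq_nonneg x)
    rw [div_le_div_iff₀ (by positivity) (by positivity)]
    nlinarith [(n.cast_nonneg : (0 : ℝ) ≤ n)]
  have h7 : x * (2 * n + 3) * (2 * (x / ((n : ℝ) + 2) ^ 2)) ≤ x * (2 * n + 3) * (A ^ 2 + B ^ 2) := by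
    gcongr
    linarith
  have h8 : 0 ≤ x * B ^ 2 := by positivity
  ring_nf at h1 h2 h6 h7 h8 ⊢
  linarith

theorem tendsto_cfSeq_mul_succ {x : ℝ} (hx : 0 < x) :
    Tendsto (fun n : ℕ => ((n : ℝ) + 1) ^ 2 * (cfSeq x 1 x (n + 1) * cfSeq x 1 x n))
      atTop atTop := by
  have key : ∀ n : ℕ, x ^ 2 * ∑ k ∈ Finset.range n, 1 / ((k : ℝ) + 1) ≤
      ((n : ℝ) + 1) ^ 2 * (cfSeq x 1 x (n + 1) * cfSeq x 1 x n) +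
      ((n : ℝ) + 2) ^ 2 * (cfSeq x 1 x (n + 2) * cfSeq x 1 x (n + 1)) := by
    intro n
    induction n with
    | zero =>
      have h1 := cfSeq_pos hx one_pos hx
      have := h1 0; have := h1 1; have := h1 2
      simp only [Finset.range_zero, Finset.sum_empty, mul_zero]
      positivity
    | succ n ih =>
      have h := cfSeq_mul_succ_add_le hx n
      rw [Finset.sum_range_succ, mul_add]
      push_cast
      ring_nf at h ih ⊢
      linarith
  rw [← tendsto_add_atTop_iff_nat 1]
  refine tendsto_atTop_mono (fun n => ?_) (Tendsto.const_mul_atTop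
    (show 0 < x ^ 2 / 2 by positivity) Real.tendsto_sum_range_one_div_nat_succ_atTop)
  have h1 := cfSeq_mul_succ_rec x n
  have h2 : 0 ≤ x * (2 * n + 3) * cfSeq x 1 x (n + 1) ^ 2 := by positivity
  have h3 := key n
  push_cast
  rw [add_assoc (n : ℝ) 1 1, one_add_one_eq_two]
  linarith

theorem tendsto_abs_cfSeq_div_sub {x : ℝ} (hx : 0 < x) :
    Tendsto (fun n : ℕ => |cfSeq x 0 2 (n + 1) / cfSeq x 1 x (n + 1) -
      cfSeq x 0 2 n / cfSeq x 1 x n|) atTop (𝓝 0) := by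
  refine ((tendsto_cfSeq_mul_succ hx).const_div_atTop 2).congr fun n => ?_
  have h0 := cfSeq_pos hx one_pos hx n
  have h1 := cfSeq_pos hx one_pos hx (n + 1)
  have h := congrArg abs (cfSeq_det x n)
  rw [abs_mul, abs_mul, abs_neg_one_pow, one_mul, abs_two,
    abs_of_nonneg (show 0 ≤ ((n : ℝ) + 1) ^ 2 by positivity)] at h
  rw [div_sub_div _ _ h1.ne' h0.ne', abs_div, abs_of_pos (mul_pos h1 h0),
    ← mul_div_mul_left |_| _ (show ((n : ℝ) + 1) ^ 2 ≠ 0 by positivity),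
    mul_comm (cfSeq x 1 x (n + 1)) (cfSeq x 0 2 n), h]

theorem bauerMuir_rec {x z : ℝ} (hxz : x = 2 * z - 1) {u : ℕ → ℝ}
    (hu : ∀ n : ℕ, ((n : ℝ) + 2) ^ 2 * u (n + 2) =
      x * (2 * n + 3) * u (n + 1) + ((n : ℝ) + 1) ^ 2 * u n) (n : ℕ) :
    ((n : ℝ) + 3) ^ 2 * ((2 * z ^ 2 + 2 * (n + 3) * z + (n + 3) ^ 2) * u (n + 3) +
        ((n : ℝ) + 3) ^ 2 * u (n + 2)) =
      (x + 2) * (2 * n + 5) * ((2 * z ^ 2 + 2 * (n + 2) * z + (n + 2) ^ 2) * u (n + 2) +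
        ((n : ℝ) + 2) ^ 2 * u (n + 1)) +
      ((n : ℝ) + 2) ^ 2 * ((2 * z ^ 2 + 2 * (n + 1) * z + (n + 1) ^ 2) * u (n + 1) +
        ((n : ℝ) + 1) ^ 2 * u n) := by
  have h0 := hu n
  have h1 := hu (n + 1)
  push_cast at h1
  subst hxz
  linear_combination (2 * z ^ 2 + 2 * (n + 3) * z + (n + 3) ^ 2) * h1 + ((n : ℝ) + 2) ^ 2 * h0

/-- The Bauer–Muir transformation relating the continued fractions at `z` and `z + 1`. -/
theorem two_mul_sq_mul_cfSeq_add_two {x z : ℝ} (hxz : x = 2 * z - 1) {a b a' b' : ℝ}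
    (h1 : 2 * z ^ 2 * b' = (2 * z ^ 2 + 2 * z + 1) * b + a)
    (h2 : 2 * z ^ 2 * (3 * (x + 2) * b' + a') =
      (2 * z ^ 2 + 4 * z + 4) * (3 * x * b + a) + 16 * b) (n : ℕ) :
    2 * z ^ 2 * cfSeq (x + 2) a' b' (n + 1) =
      (2 * z ^ 2 + 2 * (n + 1) * z + (n + 1) ^ 2) * cfSeq x a b (n + 1) +
        ((n : ℝ) + 1) ^ 2 * cfSeq x a b n := by
  induction n using Nat.twoStepInduction with
  | zero => simp [cfSeq]; linarith
  | one => simp [cfSeq]; norm_num; linarith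
  | more n ih0 ih1 =>
    have hb := bauerMuir_rec hxz (cfSeq_rec x a b) n
    have hr := cfSeq_rec (x + 2) a' b' (n + 1)
    push_cast at ih1 hr ⊢
    have h3 : ((n : ℝ) + 3) ^ 2 ≠ 0 := by positivity
    apply mul_left_cancel₀ h3
    linear_combination 2 * z ^ 2 * hr - hb + (x + 2) * (2 * n + 5) * ih1 + ((n : ℝ) + 2) ^ 2 * ih0

theorem abs_cfSeq_div_shift_le {x z : ℝ} (hx : 0 < x) (hxz : x = 2 * z - 1) (n : ℕ) :
    |cfSeq x 0 2 (n + 1) / cfSeq x 1 x (n + 1) - 1 / z ^ 2 -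
        cfSeq (x + 2) 0 2 (n + 1) / cfSeq (x + 2) 1 (x + 2) (n + 1)| ≤
      |cfSeq x 0 2 (n + 1) / cfSeq x 1 x (n + 1) - cfSeq x 0 2 n / cfSeq x 1 x n| := by
  have hz : 0 < z := by linarith
  have hq := two_mul_sq_mul_cfSeq_add_two hxz (a := 1) (b := x) (a' := 1) (b' := x + 2)
    (by subst hxz; ring) (by subst hxz; ring) n
  have hp := two_mul_sq_mul_cfSeq_add_two hxz (a := 0) (b := 2) (a' := 1 / z ^ 2)
    (b' := 2 + (x + 2) / z ^ 2) (by subst hxz; field_simp; ring)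
    (by subst hxz; field_simp; ring) n
  have hs : cfSeq (x + 2) (1 / z ^ 2) (2 + (x + 2) / z ^ 2) (n + 1) =
      cfSeq (x + 2) 0 2 (n + 1) + 1 / z ^ 2 * cfSeq (x + 2) 1 (x + 2) (n + 1) := by
    rw [eq_cfSeq (x := x + 2)
      (u := fun n => cfSeq (x + 2) 0 2 n + 1 / z ^ 2 * cfSeq (x + 2) 1 (x + 2) n) fun n => by
        linear_combination cfSeq_rec (x + 2) 0 2 n + 1 / z ^ 2 * cfSeq_rec (x + 2) 1 (x + 2) n]
    simp [cfSeq, div_eq_inv_mul]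
  rw [hs] at hp
  have q0 := cfSeq_pos hx one_pos hx n
  have q1 := cfSeq_pos hx one_pos hx (n + 1)
  have q2 := cfSeq_pos (x := x + 2) (by linarith) one_pos (by linarith : 0 < x + 2) (n + 1)
  set P0 := cfSeq x 0 2 n
  set P1 := cfSeq x 0 2 (n + 1)
  set Q0 := cfSeq x 1 x n
  set Q1 := cfSeq x 1 x (n + 1)
  set P2 := cfSeq (x + 2) 0 2 (n + 1)
  set Q2 := cfSeq (x + 2) 1 (x + 2) (n + 1)
  set t : ℝ := ((n : ℝ) + 1) ^ 2 * Q0 / (2 * z ^ 2 * Q2) with ht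
  have ht0 : 0 ≤ t := by positivity
  have ht1 : t ≤ 1 := by
    rw [ht, div_le_one (by positivity), hq]
    have : 0 ≤ (2 * z ^ 2 + 2 * (n + 1) * z + (n + 1) ^ 2) * Q1 := by positivity
    linarith
  have heq : P1 / Q1 - 1 / z ^ 2 - P2 / Q2 = t * (P1 / Q1 - P0 / Q0) := by
    have e : P1 / Q1 - 1 / z ^ 2 - P2 / Q2 =
        (P1 * (2 * z ^ 2 * Q2) - Q1 * (2 * z ^ 2 * (P2 + 1 / z ^ 2 * Q2))) /
          (Q1 * (2 * z ^ 2 * Q2)) := by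
      field_simp
      ring
    rw [e, hp, ht]
    nth_rewrite 1 [hq]
    field_simp
    ring
  rw [heq, abs_mul, abs_of_nonneg ht0]
  exact mul_le_of_le_one_left (abs_nonneg _) ht1

theorem tendsto_cfSeq_div_sub_shift {z : ℝ} (hz : 1 / 2 < z) (m : ℕ) :
    Tendsto (fun n : ℕ => cfSeq (2 * z - 1) 0 2 n / cfSeq (2 * z - 1) 1 (2 * z - 1) n -
      cfSeq (2 * (z + m) - 1) 0 2 n / cfSeq (2 * (z + m) - 1) 1 (2 * (z + m) - 1) n)
      atTop (𝓝 (∑ k ∈ Finset.range m, 1 / (z + k) ^ 2)) := by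
  induction m with
  | zero => simp
  | succ m ih =>
    have hx : 0 < 2 * (z + m) - 1 := by
      have : (0 : ℝ) ≤ m := m.cast_nonneg
      linarith
    have e : 2 * (z + m) - 1 + 2 = 2 * (z + (m + 1 : ℕ)) - 1 := by push_cast; ring
    have h := squeeze_zero_norm (fun n => (Real.norm_eq_abs _).trans_le
      (abs_cfSeq_div_shift_le hx rfl n)) (tendsto_abs_cfSeq_div_sub hx)
    rw [e] at h
    rw [Finset.sum_range_succ, ← tendsto_add_atTop_iff_nat 1]
    have h' := (((tendsto_add_atTop_iff_nat 1).2 ih).add h).add_const (1 / (z + (m : ℝ)) ^ 2)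
    rw [add_zero] at h'
    refine h'.congr fun n => ?_
    ring

theorem tendsto_cfSeq_div {z : ℝ} (hz : 1 / 2 < z) :
    Tendsto (fun n : ℕ => cfSeq (2 * z - 1) 0 2 n / cfSeq (2 * z - 1) 1 (2 * z - 1) n)
      atTop (𝓝 (∑' n : ℕ, 1 / (z + n) ^ 2)) := by
  have hS := (summable_one_div_add_nat_sq (show 0 < z by linarith)).hasSum.tendsto_sum_nat
  have hB : Tendsto (fun m : ℕ => 2 / (2 * (z + m) - 1)) atTop (𝓝 0) := by
    refine Tendsto.const_div_atTop ?_ 2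
    exact tendsto_atTop_add_const_right _ _ ((tendsto_atTop_add_const_left _ z
      tendsto_natCast_atTop_atTop).const_mul_atTop two_pos)
  rw [Metric.tendsto_atTop]
  intro ε hε
  obtain ⟨m, hm1, hm2⟩ := ((Metric.tendsto_nhds.1 hS (ε / 3) (by positivity)).and
    (hB.eventually (gt_mem_nhds (show 0 < ε / 3 by positivity)))).exists
  obtain ⟨N, hN⟩ := Metric.tendsto_atTop.1 (tendsto_cfSeq_div_sub_shift hz m) (ε / 3)
    (by positivity)
  refine ⟨N, fun n hn => ?_⟩
  have hx : 0 < 2 * (z + m) - 1 := by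
    have : (0 : ℝ) ≤ m := m.cast_nonneg
    linarith
  have hq := cfSeq_pos hx one_pos hx n
  have h0 := div_nonneg (cfSeq_nonneg (x := 2 * (z + m) - 1) hx.le le_rfl zero_le_two n) hq.le
  have h1 := (div_le_iff₀ hq).2 (cfSeq_le hx n)
  have h2 := hN n hn
  rw [Real.dist_eq, abs_lt] at *
  constructor <;> linarith

theorem trigamma_cf (z : ℝ) (hz : 1 / 2 < z)
    (p q : ℕ → ℝ)
    (hp0 : p 0 = 0) (hq0 : q 0 = 1)
    (hp1 : p 1 = 2) (hq1 : q 1 = 2 * z - 1)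
    (hp : ∀ n : ℕ, 2 ≤ n →
      p n = (2 * z - 1) * (2 * n - 1) * p (n - 1) + ((n : ℝ) - 1) ^ 4 * p (n - 2))
    (hq : ∀ n : ℕ, 2 ≤ n →
      q n = (2 * z - 1) * (2 * n - 1) * q (n - 1) + ((n : ℝ) - 1) ^ 4 * q (n - 2)) :
    trigamma z = ∑' n : ℕ, 1 / (z + n) ^ 2 ∧
    Filter.Tendsto (fun N => p N / q N) Filter.atTop (nhds (trigamma z)) := by
  have htri := trigamma_eq_tsum (z := z) (by linarith)
  refine ⟨htri, ?_⟩
  rw [htri]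
  refine (tendsto_cfSeq_div hz).congr fun n => ?_
  have hP := eq_factorial_sq_mul_cfSeq (x := 2 * z - 1) (u := p) (fun n => by
    rw [hp (n + 2) (by omega), Nat.add_sub_cancel, show n + 2 - 1 = n + 1 by omega]
    push_cast
    ring) n
  have hQ := eq_factorial_sq_mul_cfSeq (x := 2 * z - 1) (u := q) (fun n => by
    rw [hq (n + 2) (by omega), Nat.add_sub_cancel, show n + 2 - 1 = n + 1 by omega]
    push_cast
    ring) n
  rw [hp0, hp1] at hP
  rw [hq0, hq1] at hQ
  rw [hP, hQ, mul_div_mul_left _ _ (by positivity)]
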